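/- Spectrum of D^{−0−}: Let D be a simple r-regular digraph with n ≥ 1 vertices and m = n·r arcs (r ≥ 1), encoded by incidence matrices T, H : Matrix (Fin n) (Fin m) ℝ, and let A = T * Hᵀ. Let M = fromBlocks (J_{n,n} − I_n − A) (J_{n,m} − T) (J_{m,n} − Hᵀ) 0 (the adjacency matrix of the transformation D^{−0−}: the complement of D among the vertices, no arcs among the arc-vertices, an arc v→e exactly when v is NOT the tail of e, and an arc e→v exactly when v is NOT the head of e). Then for every λ ∈ ℝ: (λ² + (r + 1)·λ − r) · det(λ·I_{n+m} − M) = λ^{m−n} · (λ² − (n − r − 1)·λ + 2·m − m·n − r) · det((λ² + λ)·I_n + (λ − 1)·A). -/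

import Mathlib

open Matrix

theorem aux_rank_one {n : ℕ} (hn : 1 ≤ n) (B J : Matrix (Fin n) (Fin n) ℝ) (hJ : ∀ i j, J i j = 1)
    (s c : ℝ) (hB : ∀ i, ∑ j, B i j = s) :
    s * (B - c • J).det = (s - n * c) * B.det := by
  by_cases hs : s = 0
  · subst hs
    have : B.det = 0 := by
      rw [← Matrix.exists_mulVec_eq_zero_iff]
      refine ⟨fun _ => 1, ?_, ?_⟩
      · intro h
        have := congrFun h ⟨0, hn⟩
        simp at this
      · ext i
        simp [Matrix.mulVec, dotProduct, hB]
    simp [this]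
  · have h1 : B - c • J = B * (1 + Matrix.replicateCol Unit (fun _ : Fin n => -(c / s)) *
        Matrix.replicateRow Unit (fun _ : Fin n => (1 : ℝ))) := by
      rw [mul_add, mul_one]
      ext i j
      simp only [Matrix.sub_apply, Matrix.smul_apply, hJ, Matrix.add_apply, Matrix.mul_apply,
        Matrix.replicateCol_apply, Matrix.replicateRow_apply, Finset.univ_unique,
        Finset.sum_singleton, mul_one, ← Finset.sum_mul, hB, smul_eq_mul]
      field_simp
      ring
    rw [h1, Matrix.det_mul, Matrix.det_one_add_replicateCol_mul_replicateRow]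
    simp [dotProduct]
    field_simp
    ring

/-- Spectrum of the transformation `D^{-0-}` of a simple `r`-regular digraph. -/
theorem spectrum_minus_zero_minus (n r m : ℕ) (hn : 1 ≤ n) (hr : 1 ≤ r) (hm : m = n * r)
    (T H : Matrix (Fin n) (Fin m) ℝ)
    (hT01 : ∀ i e, T i e = 0 ∨ T i e = 1)
    (hH01 : ∀ i e, H i e = 0 ∨ H i e = 1)
    (hTcol : ∀ e, ∑ i, T i e = 1)
    (hHcol : ∀ e, ∑ i, H i e = 1)
    (hnoloop : ∀ e, ∑ v, T v e * H v e = 0)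
    (hA01 : ∀ i j, (T * Hᵀ) i j = 0 ∨ (T * Hᵀ) i j = 1)
    (hTrow : ∀ i, ∑ e, T i e = (r : ℝ))
    (hHrow : ∀ i, ∑ e, H i e = (r : ℝ))
    (Jnn : Matrix (Fin n) (Fin n) ℝ) (hJnn : ∀ i j, Jnn i j = 1)
    (Jnm : Matrix (Fin n) (Fin m) ℝ) (hJnm : ∀ i e, Jnm i e = 1)
    (Jmn : Matrix (Fin m) (Fin n) ℝ) (hJmn : ∀ e i, Jmn e i = 1)
    (A : Matrix (Fin n) (Fin n) ℝ) (hA : A = T * Hᵀ)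
    (lam : ℝ) :
    (lam ^ 2 + ((r : ℝ) + 1) * lam - (r : ℝ)) *
        (lam • (1 : Matrix (Fin n ⊕ Fin m) (Fin n ⊕ Fin m) ℝ)
          - Matrix.fromBlocks (Jnn - 1 - A) (Jnm - T) (Jmn - Hᵀ) 0).det
      = lam ^ (m - n) *
          (lam ^ 2 - ((n : ℝ) - (r : ℝ) - 1) * lam
            + 2 * (m : ℝ) - (m : ℝ) * (n : ℝ) - (r : ℝ)) *
        ((lam ^ 2 + lam) • (1 : Matrix (Fin n) (Fin n) ℝ) + (lam - 1) • A).det := by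
  have hnm : n ≤ m := by rw [hm]; exact Nat.le_mul_of_pos_right n hr
  have hArow : ∀ i, ∑ j, A i j = r := by
    intro i
    simp only [hA, Matrix.mul_apply, Matrix.transpose_apply]
    rw [Finset.sum_comm]
    simp only [← Finset.mul_sum, hHcol, mul_one, hTrow]
  have hprod : (Jnm - T) * (Jmn - Hᵀ) = A + ((m : ℝ) - 2 * r) • Jnn := by
    rw [hA]
    ext i j
    simp only [Matrix.mul_apply, Matrix.sub_apply, Matrix.add_apply, Matrix.smul_apply, hJnn,
      hJnm, hJmn, Matrix.transpose_apply, mul_sub, sub_mul, Finset.sum_sub_distrib, one_mul,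
      mul_one, hTrow, hHrow, smul_eq_mul]
    simp
    ring
  revert lam
  rw [← funext_iff]
  refine Continuous.ext_on (dense_compl_singleton (0 : ℝ)) (by fun_prop) (by fun_prop) ?_
  intro lam hlam
  have hl : lam ≠ 0 := hlam
  have hblock : lam • (1 : Matrix (Fin n ⊕ Fin m) (Fin n ⊕ Fin m) ℝ)
          - Matrix.fromBlocks (Jnn - 1 - A) (Jnm - T) (Jmn - Hᵀ) 0
      = Matrix.fromBlocks (lam • 1 - (Jnn - 1 - A)) (-(Jnm - T)) (-(Jmn - Hᵀ)) (lam • 1) := by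
    rw [← Matrix.fromBlocks_one, Matrix.fromBlocks_smul, sub_eq_add_neg, Matrix.fromBlocks_neg,
      Matrix.fromBlocks_add]
    simp [sub_eq_add_neg]
  let _ : Invertible (lam • (1 : Matrix (Fin m) (Fin m) ℝ)) :=
    ⟨lam⁻¹ • 1, by simp [smul_smul, hl], by simp [smul_smul, hl]⟩
  have hinv : ⅟ (lam • (1 : Matrix (Fin m) (Fin m) ℝ)) = lam⁻¹ • 1 := rfl
  set B := (lam ^ 2 + lam) • (1 : Matrix (Fin n) (Fin n) ℝ) + (lam - 1) • A with hBdef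
  have hB : ∀ i, ∑ j, B i j = lam ^ 2 + ((r : ℝ) + 1) * lam - r := by
    intro i
    simp only [hBdef, Matrix.add_apply, Matrix.smul_apply, smul_eq_mul, Finset.sum_add_distrib,
      ← Finset.mul_sum, hArow, Matrix.one_apply]
    simp
    ring
  have hschur : lam • 1 - (Jnn - 1 - A) - -(Jnm - T) * (lam⁻¹ • (1 : Matrix (Fin m) (Fin m) ℝ)) * -(Jmn - Hᵀ)
      = lam⁻¹ • (B - (lam + m - 2 * r) • Jnn) := by
    have : -(Jnm - T) * (lam⁻¹ • (1 : Matrix (Fin m) (Fin m) ℝ)) * -(Jmn - Hᵀ)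
        = lam⁻¹ • (A + ((m : ℝ) - 2 * r) • Jnn) := by
      rw [← hprod, Matrix.mul_smul, Matrix.mul_one, Matrix.smul_mul, Matrix.neg_mul, Matrix.mul_neg,
        neg_neg]
    rw [this, hBdef]
    ext i j
    simp only [Matrix.sub_apply, Matrix.add_apply, Matrix.smul_apply, smul_eq_mul]
    field_simp
    ring
  have key := aux_rank_one hn B Jnn hJnn _ (lam + m - 2 * r) hB
  have hpow : lam ^ m * lam⁻¹ ^ n = lam ^ (m - n) := by
    rw [pow_sub₀ _ hl hnm, inv_pow]
  have hmr : (m : ℝ) = n * r := by exact_mod_cast hm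
  beta_reduce
  rw [← hBdef]
  rw [hblock, Matrix.det_fromBlocks₂₂, hinv, hschur, Matrix.det_smul, Matrix.det_smul,
    Matrix.det_one, Fintype.card_fin, Fintype.card_fin, ← hpow]
  have e : lam ^ 2 - ((n : ℝ) - r - 1) * lam + 2 * (m : ℝ) - m * n - r
      = lam ^ 2 + ((r : ℝ) + 1) * lam - r - n * (lam + m - 2 * r) := by
    linear_combination 2 * hmr
  rw [e]
  linear_combination (lam ^ m * lam⁻¹ ^ n) * key
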